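/- Let T > 0 and let μ⁽ⁿ⁾ = {μ_t⁽ⁿ⁾, t ∈ [0,T]}, n ∈ ℕ, be random elements of C([0,T], P(ℝ)). Assume condition (A): there is a nonnegative continuous function φ on ℝ with φ(x) → ∞ as |x| → ∞ such that sup_{n∈ℕ} E[sup_{t∈[0,T]} ⟨φ, μ_t⁽ⁿ⁾⟩] < ∞. Assume condition (B): there is a countable dense subset {f_i}_{i∈ℕ} of C₀(ℝ) and constants α, β > 0 such that for every i there is a constant C_i with E[|⟨f_i, μ_t⁽ⁿ⁾⟩ − ⟨f_i, μ_s⁽ⁿ⁾⟩|^{1+α}] ≤ C_i |t − s|^{1+β} for all s, t ∈ [0,T] and all n ∈ ℕ. Then the laws of μ⁽ⁿ⁾, n ∈ ℕ, form a tight family of probability measures on C([0,T], P(ℝ)). -/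

import Mathlib

open MeasureTheory Filter Topology
open scoped ENNReal NNReal BoundedContinuousFunction ZeroAtInfty

/-- The pairing `⟨f, ν⟩ = ∫ f dν` of a bounded continuous function with a probability
measure, as a continuous map on `P(ℝ)` with its weak topology. -/
noncomputable def pairingCM (f : ℝ →ᵇ ℝ) : C(ProbabilityMeasure ℝ, ℝ) :=
  ⟨fun ν => ∫ x, f x ∂(ν : Measure ℝ),
    ProbabilityMeasure.continuous_integral_boundedContinuousFunction f⟩

/-- Integrals against a dense family in `C₀(ℝ)` determine a probability measure. -/
theorem eq_of_forall_pairingCM_eq {ι : Type*} {f : ι → C₀(ℝ, ℝ)} (hf : DenseRange f)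
    {ν ν' : ProbabilityMeasure ℝ}
    (h : ∀ i, pairingCM (f i).toBCF ν = pairingCM (f i).toBCF ν') : ν = ν' := by
  have hint (κ : ProbabilityMeasure ℝ) (g : C₀(ℝ, ℝ)) : Integrable g (κ : Measure ℝ) :=
    g.toBCF.integrable _
  have hcont (κ : ProbabilityMeasure ℝ) :
      Continuous fun g : C₀(ℝ, ℝ) => ∫ x, g x ∂(κ : Measure ℝ) := by
    refine LipschitzWith.continuous (K := 1) (LipschitzWith.of_dist_le_mul fun g g' => ?_)
    rw [dist_eq_norm, ← integral_sub (hint κ g) (hint κ g'), dist_eq_norm]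
    have := (g - g').toBCF.norm_integral_le_norm (κ : Measure ℝ)
    simpa using this
  have hall : (fun g : C₀(ℝ, ℝ) => ∫ x, g x ∂(ν : Measure ℝ)) =
      fun g => ∫ x, g x ∂(ν' : Measure ℝ) :=
    hf.equalizer (hcont ν) (hcont ν') (funext h)
  apply Subtype.ext
  change (ν : Measure ℝ) = ν'
  refine Measure.ext_of_integral_eq_on_compactlySupported fun g => ?_
  exact congrFun hall (g : C₀(ℝ, ℝ))

/-- A bound on the integrals of a function tending to infinity gives relative compactness. -/
theorem exists_isCompact_of_lintegral_le {φ : ℝ → ℝ} (hφc : Continuous φ)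
    (hφtop : Tendsto φ (cocompact ℝ) atTop) (a : ℝ≥0) :
    ∃ K : Set (ProbabilityMeasure ℝ), IsCompact K ∧ ∀ ν : ProbabilityMeasure ℝ,
      ∫⁻ x, ENNReal.ofReal (φ x) ∂(ν : Measure ℝ) ≤ a → ν ∈ K := by
  have hu : Tendsto (fun n : ℕ => a / ((n : ℝ≥0) + 1)) atTop (𝓝 0) := by
    rw [← NNReal.tendsto_coe]
    push_cast
    exact tendsto_const_div_atTop_nhds_zero_nat (a : ℝ) |>.comp (tendsto_add_atTop_nat 1)
      |>.congr fun n => by simp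
  have hK (n : ℕ) : IsCompact (φ ⁻¹' Set.Iic ((n : ℝ) + 1)) := by
    have := hφtop.eventually (eventually_gt_atTop ((n : ℝ) + 1))
    obtain ⟨t, ht, hts⟩ := mem_cocompact.1 this
    refine ht.of_isClosed_subset (isClosed_Iic.preimage hφc) fun x hx => ?_
    by_contra hxt
    exact lt_irrefl _ ((show (n : ℝ) + 1 < φ x from hts hxt).trans_le hx)
  refine ⟨_, isCompact_setOfPred_probabilityMeasure_mass_eq_compl_isCompact_le hu hK
    (Or.inl inferInstance), fun ν hν n => ?_⟩
  have hmeas : Measurable fun x => ENNReal.ofReal (φ x) := hφc.measurable.ennreal_ofReal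
  have hmarkov := (mul_meas_ge_le_lintegral (μ := (ν : Measure ℝ)) hmeas
    (ENNReal.ofReal ((n : ℝ) + 1))).trans hν
  have hn : ENNReal.ofReal ((n : ℝ) + 1) = ((n : ℝ≥0) + 1 : ℝ≥0) := by
    rw [ENNReal.ofReal, Real.toNNReal_add (by positivity) zero_le_one]; simp
  rw [← ENNReal.coe_le_coe, ProbabilityMeasure.ennreal_coeFn_eq_coeFn_toMeasure,
    ENNReal.coe_div (by positivity), ENNReal.le_div_iff_mul_le (by simp) (by simp), mul_comm, ← hn]
  refine le_trans (mul_le_mul_right (measure_mono fun x hx => ?_) _) hmarkov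
  simp only [Set.mem_compl_iff, Set.mem_preimage, Set.mem_Iic, not_le] at hx
  exact ENNReal.ofReal_le_ofReal hx.le

/-- Integration of a nonnegative continuous function is weakly lower semicontinuous. -/
theorem lowerSemicontinuous_lintegral_of_continuous {φ : ℝ → ℝ} (hφc : Continuous φ) :
    LowerSemicontinuous fun ν : ProbabilityMeasure ℝ =>
      ∫⁻ x, ENNReal.ofReal (φ x) ∂(ν : Measure ℝ) := by
  let g (k : ℕ) : ℝ →ᵇ ℝ≥0 := BoundedContinuousFunction.mkOfBound
    ⟨fun x => min (φ x).toNNReal k, by fun_prop⟩ k fun x y => by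
      rw [NNReal.dist_eq, abs_le]
      have hx : ((min (φ x).toNNReal (k : ℝ≥0) : ℝ≥0) : ℝ) ≤ k := by
        exact_mod_cast min_le_right (φ x).toNNReal (k : ℝ≥0)
      have hy : ((min (φ y).toNNReal (k : ℝ≥0) : ℝ≥0) : ℝ) ≤ k := by
        exact_mod_cast min_le_right (φ y).toNNReal (k : ℝ≥0)
      have hx0 := (min (φ x).toNNReal (k : ℝ≥0)).coe_nonneg
      have hy0 := (min (φ y).toNNReal (k : ℝ≥0)).coe_nonneg
      simp only [ContinuousMap.coe_mk]
      constructor <;> linarith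
  have hg (k : ℕ) (x : ℝ) : g k x = min (φ x).toNNReal k := rfl
  have heq : (fun ν : ProbabilityMeasure ℝ => ∫⁻ x, ENNReal.ofReal (φ x) ∂(ν : Measure ℝ)) =
      fun ν : ProbabilityMeasure ℝ => ⨆ k, ∫⁻ x, g k x ∂(ν : Measure ℝ) := by
    funext ν
    rw [← lintegral_iSup (fun k => (g k).continuous.measurable.coe_nnreal_ennreal)]
    · refine lintegral_congr fun x => le_antisymm ?_ (iSup_le fun k => ?_)
      · obtain ⟨k, hk⟩ := exists_nat_ge (φ x).toNNReal
        refine le_iSup_of_le k ?_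
        rw [hg, min_eq_left hk, ENNReal.ofReal]
      · rw [hg, ENNReal.ofReal, ENNReal.coe_le_coe]
        exact min_le_left _ _
    · intro k l hkl x
      simp only [hg, ENNReal.coe_le_coe]
      exact min_le_min_left _ (by exact_mod_cast hkl)
  rw [heq]
  exact lowerSemicontinuous_iSup fun k =>
    (ProbabilityMeasure.continuous_lintegral_boundedContinuousFunction (g k)).lowerSemicontinuous

/-- Paths in a compact set whose images under a separating sequence of continuous functions have
prescribed moduli of continuity form a compact set. -/
theorem isCompact_setOf_uniform_modulus {T : ℝ} (hT : 0 < T) {Y : Type*} [TopologicalSpace Y]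
    {K : Set Y} (hK : IsCompact K) (F : ℕ → C(Y, ℝ))
    (hF : ∀ y y', (∀ i, F i y = F i y') → y = y')
    {w : ℕ → ℕ → ℝ} (hw : ∀ i, Tendsto (w i) atTop (𝓝 0)) :
    IsCompact {x : C(Set.Icc (0 : ℝ) T, Y) | (∀ t, x t ∈ K) ∧
      ∀ i m, ∀ s t : Set.Icc (0 : ℝ) T, |(s : ℝ) - t| ≤ T / 2 ^ m →
        |F i (x s) - F i (x t)| ≤ w i m} := by
  have : CompactSpace K := isCompact_iff_compactSpace.1 hK
  let e : K → ℕ → ℝ := fun y i => F i y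
  have he : IsClosedEmbedding e := Continuous.isClosedEmbedding (by fun_prop)
    fun y y' h => Subtype.ext (hF _ _ fun i => congrFun h i)
  let _ : UniformSpace K := he.isEmbedding.comapUniformSpace e
  have hue : IsUniformInducing e := ⟨rfl⟩
  let S : Set C(Set.Icc (0 : ℝ) T, K) := {x | ∀ i m, ∀ s t : Set.Icc (0 : ℝ) T,
    |(s : ℝ) - t| ≤ T / 2 ^ m → |F i (x s) - F i (x t)| ≤ w i m}
  have hmod {i : ℕ} {δ : ℝ} (hδ : 0 < δ) : ∃ m, w i m < δ :=
    ((hw i).eventually (gt_mem_nhds hδ)).exists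
  have hnear (t : Set.Icc (0 : ℝ) T) (m : ℕ) :
      ∀ᶠ s : Set.Icc (0 : ℝ) T in 𝓝 t, |(s : ℝ) - t| ≤ T / 2 ^ m := by
    have : ContinuousAt (fun s : Set.Icc (0 : ℝ) T => |(s : ℝ) - t|) t := by fun_prop
    refine this.eventually (Iic_mem_nhds ?_)
    simp only [sub_self, abs_zero]
    positivity
  have hcont (x : Set.Icc (0 : ℝ) T → K) (hx : ∀ i m, ∀ s t : Set.Icc (0 : ℝ) T,
      |(s : ℝ) - t| ≤ T / 2 ^ m → |F i (x s) - F i (x t)| ≤ w i m) : Continuous x := by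
    rw [he.isInducing.continuous_iff, continuous_pi_iff]
    intro i
    rw [continuous_iff_continuousAt]
    intro t
    rw [ContinuousAt, Metric.tendsto_nhds]
    intro δ hδ
    obtain ⟨m, hm⟩ := hmod (i := i) hδ
    filter_upwards [hnear t m] with s hs
    exact (hx i m s t hs).trans_lt hm
  have hSc : IsCompact S := by
    refine ArzelaAscoli.isCompact_of_equicontinuous S ?_ ?_
    · have himg : ContinuousMap.toFun '' S = {x : Set.Icc (0 : ℝ) T → K |
          ∀ i m, ∀ s t : Set.Icc (0 : ℝ) T,
            |(s : ℝ) - t| ≤ T / 2 ^ m → |F i (x s) - F i (x t)| ≤ w i m} := by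
        ext x
        exact ⟨fun ⟨y, hy, hyx⟩ => hyx ▸ hy, fun hx => ⟨⟨x, hcont x hx⟩, hx, rfl⟩⟩
      rw [himg]
      refine IsClosed.isCompact ?_
      simp only [Set.ofPred_forall]
      refine isClosed_iInter fun i => isClosed_iInter fun m => isClosed_iInter fun s =>
        isClosed_iInter fun t => isClosed_iInter fun _ => ?_
      exact isClosed_le (by fun_prop) continuous_const
    · rw [hue.equicontinuous_iff]
      refine (equicontinuous_iInf_rng (u := fun i =>
        UniformSpace.comap (fun a : ℕ → ℝ => a i) inferInstance)).2 fun i => ?_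
      let _ : UniformSpace (ℕ → ℝ) := UniformSpace.comap (fun a : ℕ → ℝ => a i) inferInstance
      have hi : IsUniformInducing (fun a : ℕ → ℝ => a i) := ⟨rfl⟩
      refine hi.equicontinuous_iff.2 fun t => ?_
      rw [Metric.equicontinuousAt_iff_right]
      intro δ hδ
      obtain ⟨m, hm⟩ := hmod (i := i) hδ
      filter_upwards [hnear t m] with s hs x
      rw [dist_comm]
      exact (x.2 i m s t hs).trans_lt hm
  convert hSc.image (ContinuousMap.continuous_postcomp (⟨Subtype.val, continuous_subtype_val⟩ :
    C(K, Y))) using 1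
  ext x
  constructor
  · rintro ⟨hxK, hx⟩
    exact ⟨⟨fun t => ⟨x t, hxK t⟩, x.continuous.subtype_mk _⟩, hx, rfl⟩
  · rintro ⟨y, hy, rfl⟩
    exact ⟨fun t => (y t).2, hy⟩

/-- The `j`-th dyadic point of level `k` in `[0, T]`, truncated at `T`. -/
noncomputable def dyadicPoint {T : ℝ} (hT : 0 < T) (k j : ℕ) : Set.Icc (0 : ℝ) T :=
  Set.projIcc 0 T hT.le (T * j / 2 ^ k)

theorem abs_dyadicPoint_succ_sub_le {T : ℝ} (hT : 0 < T) (k j : ℕ) :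
    |(dyadicPoint hT k (j + 1) : ℝ) - dyadicPoint hT k j| ≤ T / 2 ^ k := by
  refine (Set.abs_projIcc_sub_projIcc hT.le).trans_eq ?_
  rw [← sub_div, ← mul_sub]
  push_cast
  rw [add_sub_cancel_left, mul_one, abs_of_pos (by positivity)]

theorem dyadicPoint_two_mul {T : ℝ} (hT : 0 < T) (k j : ℕ) :
    dyadicPoint hT (k + 1) (2 * j) = dyadicPoint hT k j := by
  unfold dyadicPoint
  congr 1
  push_cast
  rw [pow_succ]
  field_simp

theorem dyadicPoint_eq_of_le {T : ℝ} (hT : 0 < T) {k j : ℕ} (h : 2 ^ k ≤ j) :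
    dyadicPoint hT k j = ⟨T, hT.le, le_rfl⟩ := by
  refine Set.projIcc_of_right_le _ ?_
  rw [le_div_iff₀ (by positivity)]
  have : (2 : ℝ) ^ k ≤ j := by exact_mod_cast h
  gcongr

theorem tendsto_dyadicPoint_floor {T : ℝ} (hT : 0 < T) (t : Set.Icc (0 : ℝ) T) :
    Tendsto (fun k => dyadicPoint hT k ⌊2 ^ k * ((t : ℝ) / T)⌋₊) atTop (𝓝 t) := by
  have h0 : 0 ≤ (t : ℝ) / T := div_nonneg t.2.1 hT.le
  have h1 : Tendsto (fun k : ℕ => T * ((⌊(2 : ℝ) ^ k * ((t : ℝ) / T)⌋₊ : ℝ) / 2 ^ k)) atTop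
      (𝓝 (T * ((t : ℝ) / T))) := by
    refine Tendsto.const_mul _ ?_
    have := (tendsto_nat_floor_mul_div_atTop h0).comp
      (tendsto_pow_atTop_atTop_of_one_lt (one_lt_two (α := ℝ)))
    refine this.congr fun k => ?_
    simp only [Function.comp_apply]
    rw [mul_comm ((t : ℝ) / T)]
  rw [mul_div_cancel₀ _ hT.ne'] at h1
  have h2 := (continuous_projIcc (h := hT.le)).continuousAt.tendsto.comp h1
  rw [Set.projIcc_val] at h2
  refine h2.congr fun k => ?_
  simp only [Function.comp_apply, dyadicPoint, mul_div_assoc]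

/-- Dyadic chaining: geometric bounds on dyadic increments control the modulus of continuity. -/
theorem abs_sub_le_of_dyadic_increments {T : ℝ} (hT : 0 < T) {g : Set.Icc (0 : ℝ) T → ℝ}
    (hg : Continuous g) {L θ : ℝ} (hL : 0 ≤ L) (hθ0 : 0 ≤ θ) (hθ1 : θ < 1)
    (h : ∀ k j, |g (dyadicPoint hT k (j + 1)) - g (dyadicPoint hT k j)| ≤ L * θ ^ k)
    (m : ℕ) (s t : Set.Icc (0 : ℝ) T) (hst : |(s : ℝ) - t| ≤ T / 2 ^ m) :
    |g s - g t| ≤ (L + 2 * (L / (1 - θ))) * θ ^ m := by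
  let a (t : Set.Icc (0 : ℝ) T) (k : ℕ) : ℕ := ⌊2 ^ k * ((t : ℝ) / T)⌋₊
  have hnonneg (t : Set.Icc (0 : ℝ) T) (k : ℕ) : 0 ≤ 2 ^ k * ((t : ℝ) / T) :=
    mul_nonneg (by positivity) (div_nonneg t.2.1 hT.le)
  have hstep (t : Set.Icc (0 : ℝ) T) (k : ℕ) :
      dist (g (dyadicPoint hT k (a t k))) (g (dyadicPoint hT (k + 1) (a t (k + 1)))) ≤
        L * θ ^ k := by
    have hle : L * θ ^ (k + 1) ≤ L * θ ^ k :=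
      mul_le_mul_of_nonneg_left (pow_le_pow_of_le_one hθ0 hθ1.le k.le_succ) hL
    have hlo : 2 * a t k ≤ a t (k + 1) := by
      refine Nat.le_floor ?_
      have := Nat.floor_le (hnonneg t k)
      push_cast
      rw [pow_succ]
      linarith
    have hhi : a t (k + 1) < 2 * a t k + 2 := by
      refine (Nat.floor_lt (hnonneg t (k + 1))).2 ?_
      have := Nat.lt_floor_add_one (2 ^ k * ((t : ℝ) / T))
      push_cast
      rw [pow_succ]
      linarith
    rw [dist_comm, Real.dist_eq, ← dyadicPoint_two_mul hT k]
    obtain heq | heq : a t (k + 1) = 2 * a t k ∨ a t (k + 1) = 2 * a t k + 1 := by omega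
    · rw [heq, sub_self, abs_zero]
      positivity
    · rw [heq]
      exact (h _ _).trans hle
  have hlim (t : Set.Icc (0 : ℝ) T) :
      |g (dyadicPoint hT m (a t m)) - g t| ≤ L * θ ^ m / (1 - θ) :=
    dist_le_of_le_geometric_of_tendsto θ L hθ1 (hstep t)
      ((hg.tendsto t).comp (tendsto_dyadicPoint_floor hT t)) m
  have hadj {s t : Set.Icc (0 : ℝ) T} (hst : |(s : ℝ) - t| ≤ T / 2 ^ m) (hle : a t m ≤ a s m) :
      |g (dyadicPoint hT m (a s m)) - g (dyadicPoint hT m (a t m))| ≤ L * θ ^ m := by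
    have hlt : a s m < a t m + 2 := by
      refine (Nat.floor_lt (hnonneg s m)).2 ?_
      have h1 := Nat.lt_floor_add_one (2 ^ m * ((t : ℝ) / T))
      have h2 : 2 ^ m * ((s : ℝ) / T) - 2 ^ m * ((t : ℝ) / T) ≤ 1 := by
        rw [← mul_sub, ← sub_div, mul_div_assoc', div_le_one hT]
        have := (le_div_iff₀ (by positivity)).1 ((le_abs_self _).trans hst)
        linarith
      push_cast
      linarith
    obtain heq | heq : a s m = a t m ∨ a s m = a t m + 1 := by omega
    · rw [heq, sub_self, abs_zero]
      positivity
    · rw [heq]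
      exact h _ _
  have hmid : |g (dyadicPoint hT m (a s m)) - g (dyadicPoint hT m (a t m))| ≤ L * θ ^ m := by
    obtain hle | hle := le_total (a t m) (a s m)
    · exact hadj hst hle
    · rw [abs_sub_comm]
      exact hadj (by rwa [abs_sub_comm]) hle
  have hs := abs_le.1 (hlim s)
  have ht := abs_le.1 (hlim t)
  have hm := abs_le.1 hmid
  have : (L + 2 * (L / (1 - θ))) * θ ^ m = L * θ ^ m + 2 * (L * θ ^ m / (1 - θ)) := by ring
  rw [this, abs_le]
  constructor <;> linarith

/-- A **Kolmogorov moment bound** gives, outside an event of small probability, a modulus of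
continuity depending only on the constants in the bound. -/
theorem exists_modulus_of_moment_bound {T : ℝ} (hT : 0 < T) {p β C ε : ℝ} (hp : 0 < p)
    (hβ : 0 < β) (hC : 0 < C) (hε : 0 < ε) :
    ∃ w : ℕ → ℝ, Tendsto w atTop (𝓝 0) ∧
      ∀ {Ω : Type*} [MeasurableSpace Ω] (P : Measure Ω) (X : Set.Icc (0 : ℝ) T → Ω → ℝ),
        (∀ t, Measurable (X t)) → (∀ ω, Continuous fun t => X t ω) →
        (∀ s t : Set.Icc (0 : ℝ) T, ∫⁻ ω, ENNReal.ofReal (|X t ω - X s ω| ^ p) ∂P ≤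
          ENNReal.ofReal (C * |(t : ℝ) - s| ^ (1 + β))) →
        P {ω | ¬ ∀ m, ∀ s t : Set.Icc (0 : ℝ) T, |(s : ℝ) - t| ≤ T / 2 ^ m →
          |X s ω - X t ω| ≤ w m} ≤ ENNReal.ofReal ε := by
  set r : ℝ := 2 ^ (-β / 2) with hr
  have hr0 : 0 < r := by positivity
  have hr1 : r < 1 := Real.rpow_lt_one_of_one_lt_of_neg one_lt_two (by linarith)
  have hr1' : 0 < 1 - r := by linarith
  set θ : ℝ := r ^ p⁻¹
  have hθ0 : 0 < θ := by positivity
  have hθ1 : θ < 1 := Real.rpow_lt_one hr0.le hr1 (by positivity)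
  have hθp : θ ^ p = r := Real.rpow_inv_rpow hr0.le hp.ne'
  set M : ℝ := C * T ^ (1 + β) with hM
  have hM0 : 0 < M := by positivity
  set L : ℝ := (M / ((1 - r) * ε)) ^ p⁻¹
  have hL0 : 0 < L := by positivity
  have hLp : L ^ p = M / ((1 - r) * ε) := Real.rpow_inv_rpow (by positivity) hp.ne'
  have hthr (k : ℕ) : (L * θ ^ k) ^ p = M / ((1 - r) * ε) * r ^ k := by
    rw [Real.mul_rpow hL0.le (by positivity), hLp, ← Real.rpow_natCast, ← Real.rpow_mul hθ0.le,
      mul_comm (k : ℝ), Real.rpow_mul hθ0.le, hθp, Real.rpow_natCast]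
  have hbound (k : ℕ) : C * (T / 2 ^ k) ^ (1 + β) = M * ((1 / 2) ^ k * (r ^ k) ^ 2) := by
    have h2 : ((2 : ℝ) ^ k) ^ (1 + β) = 2 ^ k * ((r ^ k) ^ 2)⁻¹ := by
      rw [Real.rpow_add (by positivity), Real.rpow_one]
      congr 1
      rw [hr, ← Real.rpow_natCast, ← Real.rpow_natCast (2 ^ (-β / 2)), ← Real.rpow_natCast (_ ^ _),
        ← Real.rpow_mul (by positivity), ← Real.rpow_mul (by positivity),
        ← Real.rpow_mul (by positivity), ← Real.rpow_neg (by positivity)]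
      congr 1
      push_cast
      ring
    rw [Real.div_rpow hT.le (by positivity), h2, one_div, inv_pow, hM]
    field_simp
  refine ⟨fun m => (L + 2 * (L / (1 - θ))) * θ ^ m, ?_, ?_⟩
  · simpa using (tendsto_pow_atTop_nhds_zero_of_lt_one hθ0.le hθ1).const_mul
      (L + 2 * (L / (1 - θ)))
  intro Ω _ P X hX hXc hB
  let D (k j : ℕ) : Set Ω :=
    {ω | L * θ ^ k ≤ |X (dyadicPoint hT k (j + 1)) ω - X (dyadicPoint hT k j) ω|}
  have hD (k j : ℕ) : P (D k j) ≤ ENNReal.ofReal ((1 - r) * ε * ((1 / 2) ^ k * r ^ k)) := by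
    have hmk := mul_meas_ge_le_lintegral (μ := P)
      (f := fun ω => ENNReal.ofReal
        (|X (dyadicPoint hT k (j + 1)) ω - X (dyadicPoint hT k j) ω| ^ p))
      ((((hX _).sub (hX _)).abs.pow_const p).ennreal_ofReal) (ENNReal.ofReal ((L * θ ^ k) ^ p))
    have hle : ENNReal.ofReal ((L * θ ^ k) ^ p) * P (D k j) ≤
        ENNReal.ofReal (M * ((1 / 2) ^ k * (r ^ k) ^ 2)) := by
      refine (mul_le_mul_right (measure_mono fun ω hω => ?_) _).trans
        (hmk.trans ((hB _ _).trans ?_))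
      · exact ENNReal.ofReal_le_ofReal
          (Real.rpow_le_rpow (by positivity) hω hp.le)
      · rw [← hbound]
        refine ENNReal.ofReal_le_ofReal (mul_le_mul_of_nonneg_left ?_ hC.le)
        exact Real.rpow_le_rpow (abs_nonneg _) (abs_dyadicPoint_succ_sub_le hT k j) (by linarith)
    have hpos : 0 < (L * θ ^ k) ^ p := by positivity
    rw [mul_comm, ← ENNReal.le_div_iff_mul_le (by simp [hpos]) (by simp),
      ← ENNReal.ofReal_div_of_pos hpos, hthr] at hle
    refine hle.trans_eq (congrArg _ ?_)
    field_simp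
  have hlevel (k : ℕ) : P (⋃ j ∈ Finset.range (2 ^ k), D k j) ≤
      ENNReal.ofReal ((1 - r) * ε * r ^ k) := by
    refine (measure_biUnion_finset_le _ _).trans ((Finset.sum_le_sum fun j _ => hD k j).trans_eq ?_)
    rw [Finset.sum_const, Finset.card_range, ← ENNReal.ofReal_nsmul, nsmul_eq_mul]
    congr 1
    push_cast
    rw [one_div, inv_pow]
    field_simp
  calc P _ ≤ P (⋃ k, ⋃ j ∈ Finset.range (2 ^ k), D k j) := by
        refine measure_mono fun ω hω => ?_
        by_contra hnot
        refine hω fun m s t hst => abs_sub_le_of_dyadic_increments hT (hXc ω) hL0.le hθ0.le hθ1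
          (fun k j => ?_) m s t hst
        obtain hj | hj := lt_or_ge j (2 ^ k)
        · by_contra hlt
          exact hnot (Set.mem_iUnion.2 ⟨k, Set.mem_biUnion (Finset.mem_coe.2
            (Finset.mem_range.2 hj)) (not_le.1 hlt).le⟩)
        · rw [dyadicPoint_eq_of_le hT hj, dyadicPoint_eq_of_le hT (hj.trans j.le_succ), sub_self,
            abs_zero]
          positivity
    _ ≤ ∑' k, ENNReal.ofReal ((1 - r) * ε * r ^ k) :=
        (measure_iUnion_le _).trans (ENNReal.tsum_le_tsum hlevel)
    _ = ENNReal.ofReal ε := by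
        have hs := summable_geometric_of_lt_one hr0.le hr1
        rw [← ENNReal.ofReal_tsum_of_nonneg (fun k => by positivity) (hs.mul_left _), tsum_mul_left,
          tsum_geometric_of_lt_one hr0.le hr1]
        congr 1
        field_simp

/-- **Moment tightness criterion on `C([0,T], P(ℝ))`** (Proposition B.3 / Thm-1).
Conditions (A) and (B) imply tightness of the laws of the `μ⁽ⁿ⁾` on `C([0,T], P(ℝ))`. -/
theorem tightness_of_uniform_sup_moment_and_kolmogorov
    {Ω : Type} [MeasurableSpace Ω] (P : Measure Ω) [IsProbabilityMeasure P]
    (T : ℝ) (hT : 0 < T)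
    [MeasurableSpace C(Set.Icc (0:ℝ) T, ProbabilityMeasure ℝ)]
    [BorelSpace C(Set.Icc (0:ℝ) T, ProbabilityMeasure ℝ)]
    (μ : ℕ → Ω → C(Set.Icc (0:ℝ) T, ProbabilityMeasure ℝ))
    (hmeas : ∀ n, Measurable (μ n))
    -- condition (A): a nonnegative continuous `φ` blowing up at infinity with
    -- `sup_n E[sup_{t ∈ [0,T]} ⟨φ, μ_t⁽ⁿ⁾⟩] < ∞`
    (φ : ℝ → ℝ) (hφc : Continuous φ) (hφ0 : ∀ x, 0 ≤ φ x)
    (hφtop : Tendsto φ (cocompact ℝ) atTop)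
    (hA : ⨆ n, ∫⁻ ω, ⨆ t : Set.Icc (0:ℝ) T,
        ∫⁻ x, ENNReal.ofReal (φ x) ∂(μ n ω t : Measure ℝ) ∂P < ⊤)
    -- condition (B): Kolmogorov-type moment bounds for a countable dense family of
    -- C₀ test functions
    (f : ℕ → C₀(ℝ, ℝ)) (hf : DenseRange f)
    (α β : ℝ) (hα : 0 < α) (hβ : 0 < β)
    (hB : ∀ i, ∃ C : ℝ, ∀ n, ∀ s t : Set.Icc (0:ℝ) T,
      ∫⁻ ω, ENNReal.ofReal
          (|pairingCM (f i).toBCF (μ n ω t) - pairingCM (f i).toBCF (μ n ω s)| ^ (1 + α)) ∂P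
        ≤ ENNReal.ofReal (C * |(t : ℝ) - (s : ℝ)| ^ (1 + β))) :
    -- conclusion: tightness of the laws on `C([0,T], P(ℝ))`
    ∀ ε : ℝ, 0 < ε → ∃ 𝒦 : Set C(Set.Icc (0:ℝ) T, ProbabilityMeasure ℝ), IsCompact 𝒦 ∧
      ∀ n, 1 - ENNReal.ofReal ε ≤ P {ω | μ n ω ∈ 𝒦} := by
  intro ε hε
  set e : ℝ≥0∞ := ENNReal.ofReal ε / 2
  have he0 : e ≠ 0 := (ENNReal.half_pos (ENNReal.ofReal_pos.2 hε).ne').ne'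
  have heT : e ≠ ⊤ := ENNReal.div_ne_top ENNReal.ofReal_ne_top two_ne_zero
  set A : ℝ≥0∞ := ⨆ n, ∫⁻ ω, ⨆ t : Set.Icc (0:ℝ) T,
    ∫⁻ x, ENNReal.ofReal (φ x) ∂(μ n ω t : Measure ℝ) ∂P
  obtain ⟨a, ha0, ha⟩ : ∃ a : ℝ≥0, a ≠ 0 ∧ A ≤ a * e := by
    refine ⟨(A / e).toNNReal + 1, by positivity, ?_⟩
    rw [← ENNReal.div_le_iff he0 heT, ENNReal.coe_add,
      ENNReal.coe_toNNReal (ENNReal.div_ne_top hA.ne he0)]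
    exact le_self_add
  obtain ⟨δ, hδ0, hδ⟩ := ENNReal.exists_pos_sum_of_countable he0 ℕ
  choose C hC using hB
  choose w hw0 hw using fun i => exists_modulus_of_moment_bound hT (p := 1 + α) (β := β)
    (C := max (C i) 1) (ε := δ i) (by linarith) hβ (by positivity) (NNReal.coe_pos.2 (hδ0 i))
  obtain ⟨K, hK, hKφ⟩ := exists_isCompact_of_lintegral_le hφc hφtop a
  refine ⟨_, isCompact_setOf_uniform_modulus hT hK (fun i => pairingCM (f i).toBCF)
    (fun _ _ => eq_of_forall_pairingCM_eq hf) hw0, fun n => ?_⟩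
  have heval (t : Set.Icc (0:ℝ) T) :
      Continuous fun x : C(Set.Icc (0:ℝ) T, ProbabilityMeasure ℝ) => x t :=
    continuous_eval_const t
  let S (ω : Ω) : ℝ≥0∞ := ⨆ t : Set.Icc (0:ℝ) T,
    ∫⁻ x, ENNReal.ofReal (φ x) ∂(μ n ω t : Measure ℝ)
  have hlsc : LowerSemicontinuous fun x : C(Set.Icc (0:ℝ) T, ProbabilityMeasure ℝ) =>
      ⨆ t : Set.Icc (0:ℝ) T, ∫⁻ y, ENNReal.ofReal (φ y) ∂(x t : Measure ℝ) :=
    lowerSemicontinuous_iSup fun t =>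
      (lowerSemicontinuous_lintegral_of_continuous hφc).comp (heval t)
  have hS : Measurable S := hlsc.measurable.comp (hmeas n)
  have hPS : P {ω | a ≤ S ω} ≤ e := by
    have h1 : a * P {ω | a ≤ S ω} ≤ a * e := (mul_meas_ge_le_lintegral hS a).trans
      ((le_iSup (fun n => ∫⁻ ω, ⨆ t : Set.Icc (0:ℝ) T,
        ∫⁻ x, ENNReal.ofReal (φ x) ∂(μ n ω t : Measure ℝ) ∂P) n).trans ha)
    exact (ENNReal.mul_le_mul_iff_right (by simpa using ha0) ENNReal.coe_ne_top).1 h1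
  let B (i : ℕ) : Set Ω := {ω | ¬ ∀ m, ∀ s t : Set.Icc (0:ℝ) T, |(s : ℝ) - t| ≤ T / 2 ^ m →
    |pairingCM (f i).toBCF (μ n ω s) - pairingCM (f i).toBCF (μ n ω t)| ≤ w i m}
  have hPB (i : ℕ) : P (B i) ≤ δ i := by
    have := hw i P (fun t ω => pairingCM (f i).toBCF (μ n ω t))
      (fun t => ((pairingCM (f i).toBCF).continuous.comp (heval t)).measurable.comp (hmeas n))
      (fun ω => (pairingCM (f i).toBCF).continuous.comp (μ n ω).continuous)
      (fun s t => (hC i n s t).trans (ENNReal.ofReal_le_ofReal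
        (mul_le_mul_of_nonneg_right (le_max_left _ _) (by positivity))))
    rwa [ENNReal.ofReal_coe_nnreal] at this
  set G : Set Ω := {ω | μ n ω ∈ (_ : Set C(Set.Icc (0:ℝ) T, ProbabilityMeasure ℝ))}
  have hcompl : P Gᶜ ≤ ENNReal.ofReal ε := by
    calc P Gᶜ ≤ P ({ω | a ≤ S ω} ∪ ⋃ i, B i) := by
          refine measure_mono fun ω hω => ?_
          by_contra hnot
          rw [Set.mem_union, not_or] at hnot
          refine hω ⟨fun t => hKφ _ ?_, fun i => ?_⟩
          · exact (le_iSup (fun t : Set.Icc (0:ℝ) T =>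
              ∫⁻ x, ENNReal.ofReal (φ x) ∂(μ n ω t : Measure ℝ)) t).trans (not_le.1 hnot.1).le
          · by_contra hi
            exact hnot.2 (Set.mem_iUnion.2 ⟨i, hi⟩)
      _ ≤ e + e := (measure_union_le _ _).trans (add_le_add hPS
          ((measure_iUnion_le _).trans ((ENNReal.tsum_le_tsum hPB).trans hδ.le)))
      _ = ENNReal.ofReal ε := ENNReal.add_halves _
  rw [tsub_le_iff_right]
  calc (1 : ℝ≥0∞) = P (G ∪ Gᶜ) := by rw [Set.union_compl_self, measure_univ]
    _ ≤ P G + P Gᶜ := measure_union_le _ _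
    _ ≤ P G + ENNReal.ofReal ε := by gcongr
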